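/- Let J_1,…,J_N ∈ M_n(ℂ) be such that for every ψ ∈ ℂⁿ the positive semidefinite matrix Σ_{k=1}^N |J_kψ⟩⟨J_kψ| has rank at most 1 (equivalently, the vectors J_1ψ,…,J_Nψ span a subspace of dimension at most 1). Then either there exist V ∈ M_n(ℂ) and scalars λ_1,…,λ_N ∈ ℂ with J_k = λ_k V for all k, or there exist a vector χ ∈ ℂⁿ and vectors η_1,…,η_N ∈ ℂⁿ with J_k = |χ⟩⟨η_k| for all k. -/

import Mathlib

open Matrix

/-- Two vectors are parallel (all 2x2 minors vanish). -/
def KrausPar {ι : Type*} (u w : ι → ℂ) : Prop := ∀ i j, u i * w j = u j * w i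

lemma KrausPar.transPar {ι : Type*} {a b c : ι → ℂ} (ha : a ≠ 0) (h1 : KrausPar a b)
    (h2 : KrausPar a c) : KrausPar b c := by
  obtain ⟨p, hp⟩ := Function.ne_iff.mp ha
  intro i j
  have hpne : a p ≠ 0 := hp
  have e1 := h1 p i
  have e2 := h1 p j
  have e3 := h2 p i
  have e4 := h2 p j
  apply mul_left_cancel₀ (mul_ne_zero hpne hpne)
  calc a p * a p * (b i * c j) = (a p * b i) * (a p * c j) := by ring
    _ = (a p * b j) * (a p * c i) := by rw [e1, e2, e3, e4]; ring
    _ = _ := by ring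

lemma KrausPar.symmPar {ι : Type*} {a b : ι → ℂ} (h : KrausPar a b) : KrausPar b a := by
  intro i j
  linear_combination h j i

lemma krausPar_pair {ι κ : Type*} {u1 u2 u3 : ι → ℂ} {v1 v2 v3 : κ → ℂ}
    (h : ∀ i k, u1 i * v1 k + u2 i * v2 k = u3 i * v3 k) :
    KrausPar u1 u2 ∨ KrausPar v1 v2 := by
  by_contra! hc
  obtain ⟨h1, h2⟩ := hc
  unfold KrausPar at h1 h2
  push Not at h1 h2
  obtain ⟨i, j, hij⟩ := h1
  obtain ⟨k, l, hkl⟩ := h2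
  have : (u1 i * u2 j - u1 j * u2 i) * (v1 k * v2 l - v1 l * v2 k) = 0 := by
    have e : (u1 i * v1 k + u2 i * v2 k) * (u1 j * v1 l + u2 j * v2 l)
        = (u1 i * v1 l + u2 i * v2 l) * (u1 j * v1 k + u2 j * v2 k) := by
      rw [h, h, h, h]; ring
    linear_combination e
  rcases mul_eq_zero.mp this with h | h
  · exact hij (sub_eq_zero.mp h)
  · exact hkl (sub_eq_zero.mp h)

open scoped ComplexOrder in
lemma kraus_rank_factor {n N : ℕ} (w : Fin N → Fin n → ℂ)
    (h : (∑ k, vecMulVec (w k) (star (w k))).rank ≤ 1) :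
    ∃ (u : Fin n → ℂ) (v : Fin N → ℂ), ∀ i k, w k i = u i * v k := by
  let M : Matrix (Fin n) (Fin N) ℂ := Matrix.of fun i k => w k i
  have hM : (∑ k, vecMulVec (w k) (star (w k))) = M * Mᴴ := by
    ext i j
    simp [M, Matrix.sum_apply, vecMulVec_apply, Matrix.mul_apply]
  rw [hM, Matrix.rank_self_mul_conjTranspose] at h
  obtain ⟨u, hu⟩ := finrank_le_one_iff.mp h
  choose c hc using hu
  refine ⟨u.1, fun k => c ⟨M.mulVecLin (Pi.single k 1), LinearMap.mem_range_self _ _⟩, ?_⟩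
  intro i k
  have := congrFun (congrArg Subtype.val
    (hc ⟨M.mulVecLin (Pi.single k 1), LinearMap.mem_range_self _ _⟩)) i
  have e : M.mulVecLin (Pi.single k 1) i = w k i := by
    simp [M]
  rw [mul_comm, ← e]
  exact this.symm

/-- Structural dichotomy underlying Proposition 1 (eq. (3.4)): if for every vector `ψ`
the positive semidefinite matrix `Σ_k |J_kψ⟩⟨J_kψ|` has rank at most 1, then either all
`J_k` are scalar multiples of a common `V`, or all `J_k` are rank-one operators
`|χ⟩⟨η_k|` with a common range vector `χ`. -/
theorem kraus_rank_one_dichotomy {n N : ℕ} (J : Fin N → Matrix (Fin n) (Fin n) ℂ)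
    (h : ∀ ψ : Fin n → ℂ,
      (∑ k, vecMulVec ((J k) *ᵥ ψ) (star ((J k) *ᵥ ψ))).rank ≤ 1) :
    (∃ (V : Matrix (Fin n) (Fin n) ℂ) (lam : Fin N → ℂ), ∀ k, J k = lam k • V) ∨
    (∃ (χ : Fin n → ℂ) (η : Fin N → Fin n → ℂ), ∀ k, J k = vecMulVec χ (star (η k))) := by
  choose u v huv using fun ψ => kraus_rank_factor _ (h ψ)
  have pair : ∀ a b, KrausPar (u a) (u b) ∨ KrausPar (v a) (v b) := fun a b =>
    krausPar_pair (u3 := u (a + b)) (v3 := v (a + b)) (fun i k => by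
      rw [← huv, ← huv, ← huv, Matrix.mulVec_add, Pi.add_apply])
  have col : ∀ k i j, (J k *ᵥ Pi.single j 1) i = J k i j := fun k i j => by
    simp
  by_cases hz : ∀ ψ, u ψ = 0 ∨ v ψ = 0
  · left
    refine ⟨0, 0, fun k => ?_⟩
    ext i j
    rw [← col, huv]
    rcases hz (Pi.single j 1) with h | h <;> simp [h]
  push Not at hz
  obtain ⟨a, hua, hva⟩ := hz
  by_cases hA : ∀ ψ k, KrausPar (u a) (J k *ᵥ ψ)
  · right
    obtain ⟨p, hp⟩ := Function.ne_iff.mp hua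
    have hpne : u a p ≠ 0 := hp
    refine ⟨u a, fun k j => star (J k p j / u a p), fun k => ?_⟩
    ext i j
    have := hA (Pi.single j 1) k p i
    rw [col, col] at this
    simp only [vecMulVec_apply, Pi.star_apply, star_star]
    field_simp
    linear_combination this
  · left
    push Not at hA
    obtain ⟨b, k, hb⟩ := hA
    have hub : ¬ KrausPar (u a) (u b) := fun hp => hb fun i j => by
      rw [huv, huv]; linear_combination v b k * hp i j
    have hvb : v b ≠ 0 := fun h0 => hb fun i j => by
      rw [huv, huv, h0]; simp
    have hab := (pair a b).resolve_left hub
    have key : ∀ c, u c = 0 ∨ KrausPar (v a) (v c) := by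
      intro c
      by_cases h0 : u c = 0
      · exact Or.inl h0
      right
      rcases pair a c with h1 | h1
      · rcases pair b c with h2 | h2
        · exact absurd (h1.symmPar.transPar h0 h2.symmPar) hub
        · exact hab.symmPar.transPar hvb h2
      · exact h1
    obtain ⟨p, hp⟩ := Function.ne_iff.mp hva
    have hpne : v a p ≠ 0 := hp
    refine ⟨J p, fun k => v a k / v a p, fun k => ?_⟩
    ext i j
    rw [Matrix.smul_apply, smul_eq_mul, ← col, ← col, huv, huv]
    rcases key (Pi.single j 1) with h0 | h0
    · simp [h0]
    · have := h0 p k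
      field_simp
      linear_combination u (Pi.single j 1) i * this
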